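/- Let θ, u ∈ L²([0,T]; Ḣ^{1/2}(Ω)) ∩ L^∞([0,T]; L²(Ω)) on a two-dimensional domain Ω. Then the product θu belongs to L²([0,T]; B^{−1/2}_{2,1}(Ω)), and hence to L²([0,T]; H^{−1/2}(Ω)), with ‖θu‖_{L²_T B^{−1/2}_{2,1}} ≤ C ‖θ‖_{L^∞_T L² ∩ L²_T Ḣ^{1/2}} ‖u‖_{L^∞_T L² ∩ L²_T Ḣ^{1/2}}. -/

import Mathlib

open MeasureTheory
open scoped FourierTransform ENNReal NNReal

noncomputable section

local notation "E2" => EuclideanSpace ℝ (Fin 2)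

/-- The Littlewood–Paley symbol of the dyadic block `Δ_j` built from the cut-off `χ`. -/
def lpSymbol (χ : E2 → ℝ) (j : ℤ) (ξ : E2) : ℝ :=
  if j = -1 then χ ξ
  else if 0 ≤ j then χ ((2 : ℝ) ^ (-(j : ℝ)) • ξ) - χ ((2 : ℝ) ^ (1 - (j : ℝ)) • ξ)
  else 0

/-- The dyadic block `Δ_j f = 𝓕⁻¹(φ(2^{-j}·) 𝓕 f)` of an integrable function `f`. -/
def lpBlock (χ : E2 → ℝ) (j : ℤ) (f : E2 → ℂ) : E2 → ℂ :=
  𝓕⁻ fun ξ => (lpSymbol χ j ξ : ℂ) * 𝓕 f ξ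

/-- The `B^{-1/2}_{2,1}` norm: `∑_{j ≥ -1} 2^{-j/2} ‖Δ_j f‖_{L²}`. -/
def besovNegHalfNorm (χ : E2 → ℝ) (f : E2 → ℂ) : ℝ≥0∞ :=
  ∑' j : ℤ, ENNReal.ofReal ((2 : ℝ) ^ (-(j : ℝ) / 2)) * eLpNorm (lpBlock χ j f) 2 volume

/-- The squared homogeneous `Ḣ^{1/2}` (Gagliardo) seminorm on `ℝ²`:
`∬ |f(x)-f(y)|²/|x-y|³ dx dy` (comparable to `∫ |ξ| |f̂(ξ)|² dξ`). -/
def homHalfSq (f : E2 → ℝ) : ℝ≥0∞ :=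
  ∫⁻ x, ∫⁻ y, (‖f x - f y‖₊ : ℝ≥0∞) ^ 2 / ENNReal.ofReal (‖x - y‖ ^ 3)

section FourierL2

variable {V : Type*} [NormedAddCommGroup V] [InnerProductSpace ℝ V] [FiniteDimensional ℝ V]
  [MeasurableSpace V] [BorelSpace V]

open scoped SchwartzMap ContDiff

theorem continuous_fourier_of_integrable {f : V → ℂ} (hf : Integrable f) : Continuous (𝓕 f) :=
  VectorFourier.fourierIntegral_continuous Real.continuous_fourierChar
    (by exact continuous_inner) hf

theorem coeFn_fourier_toLp {f : V → ℂ} (hf1 : Integrable f) (hf2 : MemLp f 2) :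
    ((𝓕 (hf2.toLp f) : Lp ℂ 2 (volume : Measure V)) : V → ℂ) =ᵐ[volume] 𝓕 f := by
  refine ae_eq_of_integral_contDiff_smul_eq ?_ ?_ ?_
  · exact (Lp.memLp _).locallyIntegrable (by norm_num)
  · exact (continuous_fourier_of_integrable hf1).locallyIntegrable
  intro g hg hgs
  have hgs' : HasCompactSupport (fun x => (g x : ℂ)) := hgs.comp_left (g := Complex.ofReal) rfl
  set φ : 𝓢(V, ℂ) := hgs'.toSchwartzMap (Complex.ofRealCLM.contDiff.comp hg) with hφ
  have hφx : ∀ x, φ x = (g x : ℂ) := fun x => rfl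
  have h1 := congrArg (fun D => D φ)
    (Lp.fourier_toTemperedDistribution_eq (hf2.toLp f : Lp ℂ 2 (volume : Measure V)))
  simp only [TemperedDistribution.fourier_apply, Lp.toTemperedDistribution_apply] at h1
  have h2 : ∫ x, (𝓕 φ) x • (hf2.toLp f) x = ∫ x, (𝓕 φ) x • f x := by
    refine integral_congr_ae ?_
    filter_upwards [hf2.coeFn_toLp] with x hx
    rw [hx]
  have h3 : ∫ x, (𝓕 f x) • φ x = ∫ x, f x • (𝓕 (φ : V → ℂ) x) := by
    have := VectorFourier.integral_fourierIntegral_smul_eq_flip (μ := (volume : Measure V))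
      (ν := (volume : Measure V)) (L := innerₗ V) (f := f) (g := (φ : V → ℂ))
      Real.continuous_fourierChar (by exact continuous_inner) hf1 φ.integrable
    rw [flip_innerₗ] at this
    exact this
  have e1 : ∀ x, g x • ((𝓕 (hf2.toLp f) : Lp ℂ 2 (volume : Measure V)) : V → ℂ) x
      = φ x • ((𝓕 (hf2.toLp f) : Lp ℂ 2 (volume : Measure V)) : V → ℂ) x := by
    intro x; rw [hφx]; simp
  have e2 : ∀ x, g x • 𝓕 f x = 𝓕 f x • φ x := by
    intro x; rw [hφx]; simp [mul_comm]
  simp_rw [e1, e2]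
  rw [← h1, h2, h3]
  refine integral_congr_ae (Filter.Eventually.of_forall fun x => ?_)
  simp [SchwartzMap.fourier_coe, mul_comm]

theorem eLpNorm_fourierInv_le {g : V → ℂ} (hg1 : Integrable g) (hg2 : MemLp g 2) :
    eLpNorm (𝓕⁻ g) 2 volume ≤ eLpNorm g 2 volume := by
  have h : (𝓕⁻ g) = (𝓕 g) ∘ fun x => -x := by
    ext x; exact Real.fourierInv_eq_fourier_neg g x
  rw [h, eLpNorm_comp_measurePreserving
    (continuous_fourier_of_integrable hg1).aestronglyMeasurable
    (Measure.measurePreserving_neg _), ← eLpNorm_congr_ae (coeFn_fourier_toLp hg1 hg2)]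
  have := Lp.norm_fourier_eq (hg2.toLp g)
  rw [Lp.norm_def, Lp.norm_def, ENNReal.toReal_eq_toReal_iff' (Lp.eLpNorm_ne_top _)
    (Lp.eLpNorm_ne_top _)] at this
  rw [this, eLpNorm_congr_ae hg2.coeFn_toLp]

/-- Two isometries of `L²` intertwined by the Fourier transform on Schwartz functions are
intertwined on all of `L²`. -/
theorem fourier_intertwine {A B : Lp ℂ 2 (volume : Measure V) → Lp ℂ 2 (volume : Measure V)}
    (hA : Continuous A) (hB : Continuous B)
    (h : ∀ φ : 𝓢(V, ℂ), 𝓕 (A (φ.toLp 2)) = B (𝓕 (φ.toLp 2))) (U : Lp ℂ 2 (volume : Measure V)) :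
    𝓕 (A U) = B (𝓕 U) := by
  refine DenseRange.induction_on (p := fun U => 𝓕 (A U) = B (𝓕 U))
    (SchwartzMap.denseRange_toLpCLM (p := 2) (μ := (volume : Measure V))
      ENNReal.ofNat_ne_top) U ?_ ?_
  · have hF : Continuous (fun U : Lp ℂ 2 (volume : Measure V) => 𝓕 U) :=
      (Lp.fourierTransformₗᵢ V ℂ).continuous
    exact isClosed_eq (hF.comp hA) (hB.comp hF)
  · intro φ; exact h φ

/-- multiplication by the character `x ↦ e(⟪x, ξ⟫)` -/
def modulate (ξ : V) (f : V → ℂ) : V → ℂ := fun x => (Real.fourierChar (inner ℝ x ξ) : ℂ) * f x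

theorem aestronglyMeasurable_modulate (ξ : V) {f : V → ℂ} (hf : AEStronglyMeasurable f) :
    AEStronglyMeasurable (modulate ξ f) := by
  refine AEStronglyMeasurable.mul (Continuous.aestronglyMeasurable ?_) hf
  fun_prop

theorem memLp_modulate (ξ : V) {f : V → ℂ} {p : ℝ≥0∞} (hf : MemLp f p) :
    MemLp (modulate ξ f) p :=
  (memLp_congr_norm (aestronglyMeasurable_modulate ξ hf.1) hf.1
    (Filter.Eventually.of_forall fun x => by
      rw [modulate, norm_mul, Circle.norm_coe, one_mul])).2 hf

/-- modulation on `L²` -/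
def modLp (ξ : V) (U : Lp ℂ 2 (volume : Measure V)) : Lp ℂ 2 (volume : Measure V) :=
  (memLp_modulate ξ (Lp.memLp U)).toLp _

theorem coeFn_modLp (ξ : V) (U : Lp ℂ 2 (volume : Measure V)) :
    (modLp ξ U : V → ℂ) =ᵐ[volume] modulate ξ U := MemLp.coeFn_toLp _

theorem isometry_modLp (ξ : V) : Isometry (modLp (V := V) ξ) := by
  intro U W
  rw [modLp, modLp, Lp.edist_toLp_toLp, Lp.edist_def]
  refine eLpNorm_congr_norm_ae (Filter.Eventually.of_forall fun x => ?_)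
  simp only [Pi.sub_apply, modulate, ← mul_sub, norm_mul, Circle.norm_coe, one_mul]

/-- translation on `L²` -/
def transLp (h : V) (U : Lp ℂ 2 (volume : Measure V)) : Lp ℂ 2 (volume : Measure V) :=
  Lp.compMeasurePreserving (fun x => x + h) (measurePreserving_add_right volume h) U

theorem isometry_transLp (h : V) : Isometry (transLp (V := V) h) :=
  Lp.isometry_compMeasurePreserving _

theorem coeFn_transLp (h : V) (U : Lp ℂ 2 (volume : Measure V)) :
    (transLp h U : V → ℂ) =ᵐ[volume] fun x => U (x + h) :=
  Lp.coeFn_compMeasurePreserving _ _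

theorem fourier_transLp (h : V) (U : Lp ℂ 2 (volume : Measure V)) :
    𝓕 (transLp h U) = modLp h (𝓕 U) := by
  refine fourier_intertwine (isometry_transLp h).continuous (isometry_modLp h).continuous ?_ U
  intro φ
  have hm : MemLp (fun x => φ (x + h)) 2 (volume : Measure V) :=
    (φ.memLp 2).comp_measurePreserving (measurePreserving_add_right volume h)
  have hi : Integrable (fun x => φ (x + h)) := φ.integrable.comp_add_right h
  have e : transLp h (φ.toLp 2) = hm.toLp _ := by
    refine Lp.ext ?_
    refine (coeFn_transLp h _).trans (Filter.EventuallyEq.trans ?_ hm.coeFn_toLp.symm)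
    exact (measurePreserving_add_right volume h).quasiMeasurePreserving.ae_eq_comp
      (φ.coeFn_toLp 2 volume)
  rw [e]
  refine Lp.ext ?_
  have h1 := (𝓕 φ).coeFn_toLp 2 (volume : Measure V)
  rw [← SchwartzMap.toLp_fourier_eq] at h1
  filter_upwards [coeFn_fourier_toLp hi hm, coeFn_modLp h (𝓕 (φ.toLp 2)), h1] with x h1 h2 h3
  rw [h1, h2, modulate, h3, SchwartzMap.fourier_coe]
  have := congrFun (VectorFourier.fourierIntegral_comp_add_right Real.fourierChar
    (volume : Measure V) (innerₗ V) (φ : V → ℂ) h) x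
  rw [Circle.smul_def, smul_eq_mul] at this
  rw [real_inner_comm]
  exact this

theorem fourier_modLp (ξ : V) (U : Lp ℂ 2 (volume : Measure V)) :
    𝓕 (modLp (-ξ) U) = transLp ξ (𝓕 U) := by
  refine fourier_intertwine (isometry_modLp _).continuous (isometry_transLp _).continuous ?_ U
  intro φ
  have hm : MemLp (modulate (-ξ) φ) 2 (volume : Measure V) := memLp_modulate _ (φ.memLp 2)
  have hi : Integrable (modulate (-ξ) φ) :=
    memLp_one_iff_integrable.1 (memLp_modulate _ (memLp_one_iff_integrable.2 φ.integrable))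
  have e : modLp (-ξ) (φ.toLp 2) = hm.toLp _ := by
    refine Lp.ext ?_
    refine (coeFn_modLp _ _).trans (Filter.EventuallyEq.trans ?_ hm.coeFn_toLp.symm)
    filter_upwards [φ.coeFn_toLp 2 volume] with x hx
    simp [modulate, hx]
  rw [e]
  refine Lp.ext ?_
  have h1 := (𝓕 φ).coeFn_toLp 2 (volume : Measure V)
  rw [← SchwartzMap.toLp_fourier_eq] at h1
  have h1' := (measurePreserving_add_right volume ξ).quasiMeasurePreserving.ae_eq_comp h1
  filter_upwards [coeFn_fourier_toLp hi hm, coeFn_transLp ξ (𝓕 (φ.toLp 2)), h1'] with x h1 h2 h3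
  simp only [Function.comp] at h3
  rw [h1, h2, h3, SchwartzMap.fourier_coe, Real.fourier_eq, Real.fourier_eq]
  refine integral_congr_ae (Filter.Eventually.of_forall fun y => ?_)
  simp only [modulate, Circle.smul_def, smul_eq_mul, ← mul_assoc, ← Circle.coe_mul,
    ← AddChar.map_add_eq_mul]
  rw [inner_neg_right, inner_add_right, neg_add]

end FourierL2

section ProductAndGagliardo

variable {V : Type*} [NormedAddCommGroup V] [InnerProductSpace ℝ V] [FiniteDimensional ℝ V]
  [MeasurableSpace V] [BorelSpace V]

theorem memLp_ofReal {f : V → ℝ} (hf : MemLp f 2) : MemLp (fun x => (f x : ℂ)) 2 := hf.ofReal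

/-- The `L²` Fourier transform of a real-valued square-integrable function. -/
def l2Fourier {f : V → ℝ} (hf : MemLp f 2) : Lp ℂ 2 (volume : Measure V) :=
  𝓕 ((memLp_ofReal hf).toLp (fun x => (f x : ℂ)))

theorem enorm_fourier_mul_le {θ u : V → ℝ} (hθ : MemLp θ 2) (hu : MemLp u 2) (ξ : V) :
    ‖𝓕 (fun x => ((θ x * u x : ℝ) : ℂ)) ξ‖ₑ ≤
      ∫⁻ η, ‖l2Fourier hθ η‖ₑ *
        ‖l2Fourier hu (η + ξ)‖ₑ := by
  unfold l2Fourier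
  set Θ := (memLp_ofReal hθ).toLp _ with hΘ
  set U := (memLp_ofReal hu).toLp _ with hU
  have h1 : 𝓕 (fun x => ((θ x * u x : ℝ) : ℂ)) ξ = inner ℂ Θ (modLp (-ξ) U) := by
    rw [L2.inner_def, Real.fourier_eq]
    refine integral_congr_ae ?_
    filter_upwards [(memLp_ofReal hθ).coeFn_toLp, (memLp_ofReal hu).coeFn_toLp,
      coeFn_modLp (-ξ) U] with x h1 h2 h3
    rw [h3, modulate, ← hΘ] at *
    rw [h1, h2, Circle.smul_def, smul_eq_mul, RCLike.inner_apply, Complex.conj_ofReal,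
      inner_neg_right]
    push_cast
    ring
  rw [h1, ← Lp.inner_fourier_eq, fourier_modLp, L2.inner_def]
  refine (enorm_integral_le_lintegral_enorm _).trans (lintegral_mono_ae ?_)
  filter_upwards [coeFn_transLp ξ (𝓕 U)] with η hη
  rw [hη, RCLike.inner_apply, enorm_mul, mul_comm]
  simp

theorem lintegral_enorm_sq_Lp (U : Lp ℂ 2 (volume : Measure V)) :
    ∫⁻ x, ‖U x‖ₑ ^ 2 = ‖U‖ₑ ^ 2 := by
  rw [Lp.enorm_def, eLpNorm_eq_lintegral_rpow_enorm_toReal (by norm_num) (by norm_num),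
    ← ENNReal.rpow_natCast, ← ENNReal.rpow_mul]
  norm_num

theorem lintegral_sub_translate_sq {u : V → ℝ} (hu : MemLp u 2) (h : V) :
    ∫⁻ x, (‖u x - u (x + h)‖ₑ) ^ 2 =
      ∫⁻ ξ, ‖(Real.fourierChar (inner ℝ ξ h) : ℂ) - 1‖ₑ ^ 2 *
        ‖l2Fourier hu ξ‖ₑ ^ 2 := by
  unfold l2Fourier
  set U := (memLp_ofReal hu).toLp _ with hU
  have e1 : ∫⁻ x, (‖u x - u (x + h)‖ₑ) ^ 2 = ∫⁻ x, ‖(transLp h U - U) x‖ₑ ^ 2 := by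
    refine lintegral_congr_ae ?_
    have h1 := (memLp_ofReal hu).coeFn_toLp
    have h2 := (measurePreserving_add_right volume h).quasiMeasurePreserving.ae_eq_comp h1
    filter_upwards [Lp.coeFn_sub (transLp h U) U, coeFn_transLp h U, h1, h2] with x h3 h4 h5 h6
    simp only [Function.comp] at h6
    rw [h3, Pi.sub_apply, h4, h5, h6, ← Complex.ofReal_sub, ← enorm_neg, neg_sub,
      ← ofReal_norm, ← ofReal_norm, Complex.norm_real]
  have e2 : ‖transLp h U - U‖ₑ = ‖modLp h (𝓕 U) - 𝓕 U‖ₑ := by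
    have hs : 𝓕 (transLp h U - U) = 𝓕 (transLp h U) - 𝓕 U :=
      (Lp.fourierTransformₗᵢ V ℂ).map_sub _ _
    rw [← fourier_transLp, ← hs, ← ofReal_norm, ← ofReal_norm, Lp.norm_fourier_eq]
  rw [e1, lintegral_enorm_sq_Lp, e2, ← lintegral_enorm_sq_Lp]
  refine lintegral_congr_ae ?_
  filter_upwards [Lp.coeFn_sub (modLp h (𝓕 U)) (𝓕 U), coeFn_modLp h (𝓕 U)] with x h1 h2
  rw [h1, Pi.sub_apply, h2, modulate, ← mul_pow, ← enorm_mul, sub_mul, one_mul]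

theorem one_le_norm_fourierChar_sub_one {t : ℝ} (h1 : 1 / 4 ≤ t) (h2 : t ≤ 3 / 4) :
    1 ≤ ‖(Real.fourierChar t : ℂ) - 1‖ := by
  have hre : ((Real.fourierChar t : ℂ)).re = Real.cos (2 * Real.pi * t) := by
    rw [Real.fourierChar_apply, Complex.exp_ofReal_mul_I_re]
  have hc : Real.cos (2 * Real.pi * t) ≤ 0 := by
    apply Real.cos_nonpos_of_pi_div_two_le_of_le <;> nlinarith [Real.pi_pos]
  have := Complex.abs_re_le_norm ((Real.fourierChar t : ℂ) - 1)
  rw [Complex.sub_re, hre, Complex.one_re] at this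
  have h3 := neg_abs_le (Real.cos (2 * Real.pi * t) - 1)
  linarith

theorem exists_le_lintegral_fourierChar :
    ∃ c : ℝ≥0∞, c ≠ 0 ∧ c ≠ ∞ ∧ ∀ ξ : E2, c * ‖ξ‖ₑ ≤
      ∫⁻ h : E2, ‖(Real.fourierChar (inner ℝ ξ h) : ℂ) - 1‖ₑ ^ 2 / ENNReal.ofReal (‖h‖ ^ 3) := by
  refine ⟨ENNReal.ofReal (1 / 16) * volume (Metric.ball (0 : E2) 1),
    mul_ne_zero (by norm_num) (Metric.measure_ball_pos _ _ one_pos).ne',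
    ENNReal.mul_ne_top ENNReal.ofReal_ne_top measure_ball_lt_top.ne, fun ξ => ?_⟩
  rcases eq_or_ne ξ 0 with rfl | hξ
  · simp
  have hp : 0 < ‖ξ‖ := norm_pos_iff.2 hξ
  set h₀ : E2 := (1 / (2 * ‖ξ‖ ^ 2)) • ξ with hh₀
  set r : ℝ := 1 / (4 * ‖ξ‖) with hr
  have hr0 : 0 < r := by positivity
  have hh₀n : ‖h₀‖ = 1 / (2 * ‖ξ‖) := by
    rw [hh₀, norm_smul, Real.norm_of_nonneg (by positivity)]
    field_simp
  have hin : inner ℝ ξ h₀ = 1 / 2 := by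
    rw [hh₀, inner_smul_right, real_inner_self_eq_norm_sq]
    field_simp
  have key : ∀ h ∈ Metric.ball h₀ r, ENNReal.ofReal (‖ξ‖ ^ 3) ≤
      ‖(Real.fourierChar (inner ℝ ξ h) : ℂ) - 1‖ₑ ^ 2 / ENNReal.ofReal (‖h‖ ^ 3) := by
    intro h hh
    rw [mem_ball_iff_norm] at hh
    have hi : |inner ℝ ξ h - 1 / 2| ≤ 1 / 4 := by
      rw [← hin, ← inner_sub_right]
      refine (abs_real_inner_le_norm _ _).trans ?_
      calc ‖ξ‖ * ‖h - h₀‖ ≤ ‖ξ‖ * r := by gcongr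
        _ = 1 / 4 := by rw [hr]; field_simp
    rw [abs_le] at hi
    have h1 := one_le_norm_fourierChar_sub_one (t := inner ℝ ξ h) (by linarith) (by linarith)
    have hn : ‖h‖ ≤ 1 / ‖ξ‖ := by
      have : ‖h‖ ≤ ‖h - h₀‖ + ‖h₀‖ := by simpa using norm_add_le (h - h₀) h₀
      have e : r + 1 / (2 * ‖ξ‖) ≤ 1 / ‖ξ‖ := by
        rw [hr]; field_simp; norm_num
      linarith [hh₀n]
    have h2 : (1 : ℝ≥0∞) ≤ ‖(Real.fourierChar (inner ℝ ξ h) : ℂ) - 1‖ₑ := by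
      rw [← ofReal_norm, ← ENNReal.ofReal_one]
      exact ENNReal.ofReal_le_ofReal h1
    calc ENNReal.ofReal (‖ξ‖ ^ 3) = 1 / ENNReal.ofReal ((1 / ‖ξ‖) ^ 3) := by
          rw [one_div, ← ENNReal.ofReal_inv_of_pos (by positivity)]
          congr 1
          field_simp
      _ ≤ _ := by
          gcongr
          exact one_le_pow₀ h2
  calc ENNReal.ofReal (1 / 16) * volume (Metric.ball (0 : E2) 1) * ‖ξ‖ₑ
      = ENNReal.ofReal (‖ξ‖ ^ 3) * volume (Metric.ball h₀ r) := by
        rw [Measure.addHaar_ball _ _ hr0.le, ← ofReal_norm, ← mul_assoc, mul_right_comm,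
          ← ENNReal.ofReal_mul (by norm_num), ← ENNReal.ofReal_mul (by positivity)]
        congr 2
        rw [hr, finrank_euclideanSpace_fin]
        field_simp
        norm_num
    _ = ∫⁻ h in Metric.ball h₀ r, ENNReal.ofReal (‖ξ‖ ^ 3) := by simp
    _ ≤ ∫⁻ h in Metric.ball h₀ r,
          ‖(Real.fourierChar (inner ℝ ξ h) : ℂ) - 1‖ₑ ^ 2 / ENNReal.ofReal (‖h‖ ^ 3) :=
        setLIntegral_mono' measurableSet_ball key
    _ ≤ _ := setLIntegral_le_lintegral _ _

theorem homHalfSq_eq {u : E2 → ℝ} (hum : Measurable u) :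
    homHalfSq u = ∫⁻ h : E2, (∫⁻ x, ‖u x - u (x + h)‖ₑ ^ 2) / ENNReal.ofReal (‖h‖ ^ 3) := by
  have e : homHalfSq u =
      ∫⁻ x : E2, ∫⁻ h : E2, ‖u x - u (x + h)‖ₑ ^ 2 / ENNReal.ofReal (‖h‖ ^ 3) := by
    refine lintegral_congr fun x => ?_
    rw [← lintegral_add_left_eq_self _ x]
    refine lintegral_congr fun h => ?_
    rw [sub_add_cancel_left, norm_neg]
    rfl
  rw [e, lintegral_lintegral_swap]
  · refine lintegral_congr fun h => ?_
    simp_rw [div_eq_mul_inv]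
    rw [lintegral_mul_const]
    fun_prop
  · refine Measurable.aemeasurable ?_
    simp only [Function.uncurry_def]
    fun_prop

theorem exists_lintegral_fourier_le_homHalfSq :
    ∃ K : ℝ≥0∞, K ≠ ∞ ∧ ∀ u : E2 → ℝ, Measurable u → ∀ hu : MemLp u 2,
      ∫⁻ ξ, ‖ξ‖ₑ * ‖l2Fourier hu ξ‖ₑ ^ 2
        ≤ K * homHalfSq u := by
  obtain ⟨c, hc0, hct, hc⟩ := exists_le_lintegral_fourierChar
  refine ⟨c⁻¹, ENNReal.inv_ne_top.2 hc0, fun u hum hu => ?_⟩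
  set W := l2Fourier hu with hW
  have hWm : Measurable fun ξ => ‖W ξ‖ₑ := (Lp.stronglyMeasurable W).measurable.enorm
  rw [← ENNReal.div_eq_inv_mul, ENNReal.le_div_iff_mul_le (Or.inl hc0) (Or.inl hct), mul_comm,
    ← lintegral_const_mul _ (by fun_prop), homHalfSq_eq hum]
  calc ∫⁻ ξ, c * (‖ξ‖ₑ * ‖W ξ‖ₑ ^ 2)
      ≤ ∫⁻ ξ, ∫⁻ h : E2, (‖(Real.fourierChar (inner ℝ ξ h) : ℂ) - 1‖ₑ ^ 2 * ‖W ξ‖ₑ ^ 2) /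
          ENNReal.ofReal (‖h‖ ^ 3) := by
        refine lintegral_mono fun ξ => ?_
        rw [← mul_assoc]
        refine (mul_le_mul_left (hc ξ) _).trans_eq ?_
        rw [← lintegral_mul_const]
        · refine lintegral_congr fun h => ?_
          rw [ENNReal.mul_div_right_comm]
        · fun_prop
    _ = _ := by
        rw [lintegral_lintegral_swap]
        · refine lintegral_congr fun h => ?_
          rw [lintegral_sub_translate_sq hu h]
          simp_rw [div_eq_mul_inv]
          rw [lintegral_mul_const]
          fun_prop
        · refine Measurable.aemeasurable ?_
          simp only [Function.uncurry_def]
          have : Measurable fun p : E2 × E2 => ‖W p.1‖ₑ := hWm.comp measurable_fst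
          fun_prop

end ProductAndGagliardo

section DyadicSums

/-- the dyadic number `2 ^ j` in `ℝ≥0∞` -/
def dyad (j : ℤ) : ℝ≥0∞ := ENNReal.ofReal ((2 : ℝ) ^ j)

theorem dyad_ne_zero (j : ℤ) : dyad j ≠ 0 := by
  rw [dyad, Ne, ENNReal.ofReal_eq_zero, not_le]; positivity

theorem dyad_ne_top (j : ℤ) : dyad j ≠ ∞ := ENNReal.ofReal_ne_top

theorem dyad_add_one (j : ℤ) : dyad (j + 1) = 2 * dyad j := by
  rw [dyad, dyad, zpow_add_one₀ two_ne_zero, mul_comm, ENNReal.ofReal_mul (by norm_num)]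
  norm_num

theorem dyad_sub_natCast (m : ℤ) (k : ℕ) : dyad (m - k) = dyad m * (2⁻¹) ^ k := by
  induction k with
  | zero => simp
  | succ k ih =>
    have h := dyad_add_one (m - (k + 1 : ℕ))
    have e : m - ((k + 1 : ℕ) : ℤ) + 1 = m - k := by push_cast; ring
    rw [e, ih] at h
    rw [pow_succ, ← mul_assoc, h, mul_comm 2, mul_assoc,
      ENNReal.mul_inv_cancel two_ne_zero ENNReal.ofNat_ne_top, mul_one]

theorem dyad_neg (j : ℤ) : dyad (-j) = (dyad j)⁻¹ := by
  rw [dyad, dyad, zpow_neg, ENNReal.ofReal_inv_of_pos (by positivity)]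

theorem exists_tsum_dyad_le {s : ℝ} (hs : 0 < s) :
    ∃ K : ℝ≥0∞, K ≠ ∞ ∧ ∀ m : ℤ, ∑' j : ℤ, (if j ≤ m then dyad j ^ s else 0) ≤ K * dyad m ^ s := by
  refine ⟨(1 - (2⁻¹ : ℝ≥0∞) ^ s)⁻¹, ?_, fun m => ?_⟩
  · rw [ENNReal.inv_ne_top, Ne, tsub_eq_zero_iff_le, not_le]
    exact ENNReal.rpow_lt_one (ENNReal.inv_lt_one.2 ENNReal.one_lt_two) hs
  have hinj : Function.Injective fun k : ℕ => m - (k : ℤ) := by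
    intro k l h
    simpa using h
  rw [← hinj.tsum_eq]
  · rw [← ENNReal.tsum_geometric, mul_comm, ← ENNReal.tsum_mul_left]
    refine ENNReal.tsum_le_tsum fun k => ?_
    rw [if_pos (by lia), dyad_sub_natCast, ENNReal.mul_rpow_of_nonneg _ _ hs.le,
      ← ENNReal.rpow_natCast, ← ENNReal.rpow_natCast, ← ENNReal.rpow_mul, ← ENNReal.rpow_mul,
      mul_comm s]
  · intro j hj
    have hj' : j ≤ m := by
      by_contra h
      simp [h] at hj
    exact ⟨(m - j).toNat, by simp only; lia⟩

theorem exists_tsum_dyad_neg_le {s : ℝ} (hs : 0 < s) :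
    ∃ K : ℝ≥0∞, K ≠ ∞ ∧ ∀ m : ℤ,
      ∑' j : ℤ, (if m ≤ j then dyad j ^ (-s) else 0) ≤ K * dyad m ^ (-s) := by
  obtain ⟨K, hK, h⟩ := exists_tsum_dyad_le hs
  refine ⟨K, hK, fun m => ?_⟩
  have := h (-m)
  rw [← (Equiv.neg ℤ).tsum_eq] at this
  simp only [Equiv.neg_apply, neg_le_neg_iff, dyad_neg, ENNReal.inv_rpow] at this
  simpa only [ENNReal.rpow_neg] using this

theorem exists_dyad_le_lt {x : E2} (hx : x ≠ 0) :
    ∃ n : ℤ, (2 : ℝ) ^ n ≤ ‖x‖ ∧ ‖x‖ < (2 : ℝ) ^ (n + 1) :=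
  exists_mem_Ico_zpow (norm_pos_iff.2 hx) one_lt_two

theorem dyad_le_enorm {x : E2} {n : ℤ} (h : (2 : ℝ) ^ n ≤ ‖x‖) : dyad n ≤ ‖x‖ₑ := by
  rw [dyad, ← ofReal_norm]; exact ENNReal.ofReal_le_ofReal h

theorem enorm_le_dyad {x : E2} {n : ℤ} (h : ‖x‖ < (2 : ℝ) ^ n) : ‖x‖ₑ ≤ dyad n := by
  rw [dyad, ← ofReal_norm]; exact ENNReal.ofReal_le_ofReal h.le

theorem exists_tsum_dyad_le_enorm {s : ℝ} (hs : 0 < s) :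
    ∃ K : ℝ≥0∞, K ≠ ∞ ∧ ∀ x : E2,
      ∑' j : ℤ, (if (2 : ℝ) ^ j ≤ ‖x‖ then dyad j ^ s else 0) ≤ K * ‖x‖ₑ ^ s := by
  obtain ⟨K, hK, h⟩ := exists_tsum_dyad_le hs
  refine ⟨K, hK, fun x => ?_⟩
  rcases eq_or_ne x 0 with rfl | hx
  · refine le_of_eq_of_le ?_ zero_le
    refine ENNReal.tsum_eq_zero.2 fun j => if_neg ?_
    rw [norm_zero, not_le]
    positivity
  obtain ⟨n, hn1, hn2⟩ := exists_dyad_le_lt hx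
  calc _ ≤ ∑' j : ℤ, (if j ≤ n then dyad j ^ s else 0) := by
        refine ENNReal.tsum_le_tsum fun j => ?_
        split_ifs with h1 h2
        · exact le_rfl
        · have := (zpow_lt_zpow_iff_right₀ (one_lt_two (α := ℝ))).1 (h1.trans_lt hn2)
          lia
        · exact zero_le
        · exact le_rfl
    _ ≤ K * dyad n ^ s := h n
    _ ≤ _ := by
        gcongr
        exact dyad_le_enorm hn1

theorem exists_tsum_dyad_neg_le_enorm {s : ℝ} (hs : 0 < s) :
    ∃ K : ℝ≥0∞, K ≠ ∞ ∧ ∀ x : E2, x ≠ 0 →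
      ∑' j : ℤ, (if ‖x‖ < (2 : ℝ) ^ j then dyad j ^ (-s) else 0) ≤ K * ‖x‖ₑ ^ (-s) := by
  obtain ⟨K, hK, h⟩ := exists_tsum_dyad_neg_le hs
  refine ⟨K, hK, fun x hx => ?_⟩
  obtain ⟨n, hn1, hn2⟩ := exists_dyad_le_lt hx
  calc _ ≤ ∑' j : ℤ, (if n + 1 ≤ j then dyad j ^ (-s) else 0) := by
        refine ENNReal.tsum_le_tsum fun j => ?_
        split_ifs with h1 h2
        · exact le_rfl
        · have := (zpow_lt_zpow_iff_right₀ (one_lt_two (α := ℝ))).1 (hn1.trans_lt h1)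
          lia
        · exact zero_le
        · exact le_rfl
    _ ≤ K * dyad (n + 1) ^ (-s) := h _
    _ ≤ _ := by
        rw [ENNReal.rpow_neg, ENNReal.rpow_neg]
        gcongr
        exact enorm_le_dyad hn2

theorem volume_ball_dyad (j : ℤ) :
    volume (Metric.ball (0 : E2) ((2 : ℝ) ^ j)) = dyad j ^ 2 * volume (Metric.ball (0 : E2) 1) := by
  rw [Measure.addHaar_ball _ _ (by positivity), finrank_euclideanSpace_fin,
    ENNReal.ofReal_pow (by positivity), dyad]

theorem exists_setLIntegral_inv_enorm_le :
    ∃ K : ℝ≥0∞, K ≠ ∞ ∧ ∀ j : ℤ,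
      ∫⁻ x in Metric.ball (0 : E2) ((2 : ℝ) ^ j), ‖x‖ₑ⁻¹ ≤ K * dyad j := by
  obtain ⟨K, hK, h⟩ := exists_tsum_dyad_le one_pos
  set vB := volume (Metric.ball (0 : E2) 1) with hvB
  have hvB' : vB ≠ ∞ := measure_ball_lt_top.ne
  refine ⟨2 * vB * K, by finiteness, fun j => ?_⟩
  have hae : ∀ᵐ x : E2, x ≠ 0 := by simp [ae_iff]
  calc ∫⁻ x in Metric.ball (0 : E2) ((2 : ℝ) ^ j), ‖x‖ₑ⁻¹
      ≤ ∫⁻ x : E2, ∑' i : ℤ, (Metric.ball (0 : E2) ((2 : ℝ) ^ i)).indicator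
          (fun _ => if i ≤ j then 2 * (dyad i)⁻¹ else 0) x := by
        rw [← lintegral_indicator measurableSet_ball]
        refine lintegral_mono_ae ?_
        filter_upwards [hae] with x hx
        by_cases hxj : x ∈ Metric.ball (0 : E2) ((2 : ℝ) ^ j)
        · rw [Set.indicator_of_mem hxj]
          rw [mem_ball_zero_iff] at hxj
          obtain ⟨n, hn1, hn2⟩ := exists_dyad_le_lt hx
          have hnj := (zpow_lt_zpow_iff_right₀ (one_lt_two (α := ℝ))).1 (hn1.trans_lt hxj)
          refine le_trans ?_ (ENNReal.le_tsum (n + 1))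
          rw [Set.indicator_of_mem (mem_ball_zero_iff.2 hn2), if_pos (by lia), dyad_add_one,
            ENNReal.mul_inv (by simp) (by simp), ← mul_assoc,
            ENNReal.mul_inv_cancel two_ne_zero ENNReal.ofNat_ne_top, one_mul]
          exact ENNReal.inv_le_inv.2 (dyad_le_enorm hn1)
        · rw [Set.indicator_of_notMem hxj]
          exact zero_le
    _ = ∑' i : ℤ, 2 * vB * (if i ≤ j then dyad i ^ (1 : ℝ) else 0) := by
        rw [lintegral_tsum]
        · refine tsum_congr fun i => ?_
          rw [lintegral_indicator measurableSet_ball, setLIntegral_const, volume_ball_dyad,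
            ENNReal.rpow_one]
          split_ifs
          · rw [← hvB, sq, mul_assoc 2, ← mul_assoc (dyad i)⁻¹, ← mul_assoc (dyad i)⁻¹,
              ENNReal.inv_mul_cancel (dyad_ne_zero i) (dyad_ne_top i), one_mul, mul_assoc,
              mul_comm vB]
          · simp
        · exact fun i => (measurable_const.indicator measurableSet_ball).aemeasurable
    _ ≤ _ := by
        rw [ENNReal.tsum_mul_left, mul_assoc (2 * vB)]
        gcongr
        simpa using h j

end DyadicSums

section Bilinear

theorem sq_lintegral_mul_le {α : Type*} [MeasurableSpace α] (μ : Measure α) {f g : α → ℝ≥0∞}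
    (hf : AEMeasurable f μ) (hg : AEMeasurable g μ) :
    (∫⁻ x, f x * g x ∂μ) ^ 2 ≤ (∫⁻ x, f x ^ 2 ∂μ) * ∫⁻ x, g x ^ 2 ∂μ := by
  have h := ENNReal.lintegral_mul_le_Lp_mul_Lq μ Real.HolderConjugate.two_two hf hg
  simp only [Pi.mul_apply] at h
  have h2 := pow_le_pow_left' h 2
  refine h2.trans_eq ?_
  rw [mul_pow, ← ENNReal.rpow_natCast, ← ENNReal.rpow_natCast, ← ENNReal.rpow_mul,
    ← ENNReal.rpow_mul]
  norm_num

theorem tsum_sqrt_mul_sqrt_le (P Q : ℤ → ℝ≥0∞) :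
    ∑' j, P j ^ (1 / 2 : ℝ) * Q j ^ (1 / 2 : ℝ) ≤
      (∑' j, P j) ^ (1 / 2 : ℝ) * (∑' j, Q j) ^ (1 / 2 : ℝ) := by
  have h := ENNReal.lintegral_mul_le_Lp_mul_Lq (Measure.count : Measure ℤ)
    Real.HolderConjugate.two_two (f := fun j => P j ^ (1 / 2 : ℝ))
    (g := fun j => Q j ^ (1 / 2 : ℝ)) (Measurable.of_discrete).aemeasurable
    (Measurable.of_discrete).aemeasurable
  simp only [Pi.mul_apply, lintegral_count, ← ENNReal.rpow_mul] at h
  norm_num at h ⊢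
  exact h

/-- Young's inequality `L¹ * L² ⊆ L²` for correlations. -/
theorem lintegral_sq_corr_le {f g : E2 → ℝ≥0∞} (hf : Measurable f) (hg : Measurable g) :
    ∫⁻ ξ, (∫⁻ η, f η * g (η + ξ)) ^ 2 ≤ (∫⁻ η, f η) ^ 2 * ∫⁻ η, g η ^ 2 := by
  have hs : ∀ t : ℝ≥0∞, t ^ (1 / 2 : ℝ) * t ^ (1 / 2 : ℝ) = t := fun t => by
    rw [← ENNReal.rpow_add_of_nonneg _ _ (by norm_num) (by norm_num)]; norm_num
  have hs2 : ∀ t : ℝ≥0∞, (t ^ (1 / 2 : ℝ)) ^ 2 = t := fun t => by rw [sq, hs]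
  calc ∫⁻ ξ, (∫⁻ η, f η * g (η + ξ)) ^ 2
      ≤ ∫⁻ ξ, (∫⁻ η, f η) * ∫⁻ η, f η * g (η + ξ) ^ 2 := by
        refine lintegral_mono fun ξ => ?_
        have := sq_lintegral_mul_le volume (f := fun η => f η ^ (1 / 2 : ℝ))
          (g := fun η => f η ^ (1 / 2 : ℝ) * g (η + ξ)) (by fun_prop) (by fun_prop)
        simpa only [mul_pow, hs2, ← mul_assoc, hs] using this
    _ = (∫⁻ η, f η) * ∫⁻ η, ∫⁻ ξ, f η * g (η + ξ) ^ 2 := by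
        rw [lintegral_const_mul]
        · rw [lintegral_lintegral_swap]
          refine Measurable.aemeasurable ?_
          simp only [Function.uncurry_def]
          fun_prop
        · refine Measurable.lintegral_prod_right' (f := fun p : E2 × E2 =>
            f p.2 * g (p.2 + p.1) ^ 2) ?_
          fun_prop
    _ = _ := by
        have : ∀ η, ∫⁻ ξ, f η * g (η + ξ) ^ 2 = f η * ∫⁻ x, g x ^ 2 := fun η => by
          rw [lintegral_const_mul _ (by fun_prop),
            lintegral_add_left_eq_self (fun x => g x ^ 2) η]
        simp_rw [this]
        rw [lintegral_mul_const _ hf, ← mul_assoc, sq]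

theorem lintegral_sq_corr_le' {f g : E2 → ℝ≥0∞} (hf : Measurable f) (hg : Measurable g) :
    ∫⁻ ξ, (∫⁻ η, g η * f (η + ξ)) ^ 2 ≤ (∫⁻ η, f η) ^ 2 * ∫⁻ η, g η ^ 2 := by
  refine le_of_eq_of_le ?_ (lintegral_sq_corr_le hf hg)
  rw [← lintegral_neg_eq_self]
  refine lintegral_congr fun ξ => ?_
  rw [← lintegral_add_right_eq_self _ ξ]
  simp [mul_comm]

theorem sq_add_add_le (x y z : ℝ≥0∞) : (x + y + z) ^ 2 ≤ 9 * (x ^ 2 + y ^ 2 + z ^ 2) := by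
  have key : ∀ m : ℝ≥0∞, x ≤ m → y ≤ m → z ≤ m → (x + y + z) ^ 2 ≤ 9 * m ^ 2 := by
    intro m hx hy hz
    calc (x + y + z) ^ 2 ≤ (m + m + m) ^ 2 := by gcongr
      _ = 9 * m ^ 2 := by ring
  rcases le_total x y with h1 | h1 <;> rcases le_total y z with h2 | h2 <;>
    rcases le_total x z with h3 | h3
  · exact (key z h3 h2 le_rfl).trans (by gcongr; exact le_add_self)
  · exact (key z (h1.trans h2) h2 le_rfl).trans (by gcongr; exact le_add_self)
  · exact (key y h1 le_rfl h2).trans (by gcongr; exact le_add_self.trans le_self_add)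
  · exact (key y h1 le_rfl h2).trans (by gcongr; exact le_add_self.trans le_self_add)
  · exact (key z h3 h2 le_rfl).trans (by gcongr; exact le_add_self)
  · exact (key x le_rfl h1 h3).trans (by gcongr; rw [add_assoc]; exact le_self_add)
  · exact (key x le_rfl h1 (h2.trans h1)).trans (by gcongr; rw [add_assoc]; exact le_self_add)
  · exact (key x le_rfl h1 h3).trans (by gcongr; rw [add_assoc]; exact le_self_add)

/-- restriction to frequencies below `2 ^ j` -/
def lowPart (j : ℤ) (a : E2 → ℝ≥0∞) : E2 → ℝ≥0∞ :=
  (Metric.ball (0 : E2) ((2 : ℝ) ^ j)).indicator a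

/-- restriction to frequencies at least `2 ^ j` -/
def highPart (j : ℤ) (a : E2 → ℝ≥0∞) : E2 → ℝ≥0∞ :=
  (Metric.ball (0 : E2) ((2 : ℝ) ^ j))ᶜ.indicator a

theorem measurable_lowPart (j : ℤ) {a : E2 → ℝ≥0∞} (ha : Measurable a) :
    Measurable (lowPart j a) := ha.indicator measurableSet_ball

theorem measurable_highPart (j : ℤ) {a : E2 → ℝ≥0∞} (ha : Measurable a) :
    Measurable (highPart j a) := ha.indicator measurableSet_ball.compl

/-- the annulus `2 ^ (j + 1) ≤ ‖ξ‖ < 2 ^ (j + 3)` -/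
def annulus (j : ℤ) : Set E2 := {ξ | (2 : ℝ) ^ (j + 1) ≤ ‖ξ‖ ∧ ‖ξ‖ < (2 : ℝ) ^ (j + 3)}

theorem measurableSet_annulus (j : ℤ) : MeasurableSet (annulus j) :=
  (measurableSet_le measurable_const measurable_norm).inter
    (measurableSet_lt measurable_norm measurable_const)

theorem volume_annulus_le (j : ℤ) :
    volume (annulus j) ≤ 64 * dyad j ^ 2 * volume (Metric.ball (0 : E2) 1) := by
  have h : annulus j ⊆ Metric.ball 0 ((2 : ℝ) ^ (j + 3)) := fun ξ hξ => mem_ball_zero_iff.2 hξ.2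
  refine (measure_mono h).trans_eq ?_
  rw [volume_ball_dyad, show j + 3 = j + 1 + 1 + 1 by ring, dyad_add_one, dyad_add_one,
    dyad_add_one]
  ring

theorem mul_le_of_mem_annulus {a b : E2 → ℝ≥0∞} {j : ℤ} {ξ : E2} (hξ : ξ ∈ annulus j) (η : E2) :
    a η * b (η + ξ) ≤ lowPart j a η * highPart j b (η + ξ) +
      highPart j a η * lowPart j b (η + ξ) + highPart j a η * highPart j b (η + ξ) := by
  by_cases h1 : η ∈ Metric.ball (0 : E2) ((2 : ℝ) ^ j) <;>
    by_cases h2 : η + ξ ∈ Metric.ball (0 : E2) ((2 : ℝ) ^ j)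
  · exfalso
    rw [mem_ball_zero_iff] at h1 h2
    have h3 := hξ.1
    rw [zpow_add_one₀ two_ne_zero] at h3
    have h4 : ‖ξ‖ ≤ ‖η + ξ‖ + ‖η‖ := by simpa using norm_sub_le (η + ξ) η
    linarith
  all_goals simp [lowPart, highPart, h1, h2]

/-- the dyadic quantity controlling the scale `2 ^ j` -/
def scaleSq (a : E2 → ℝ≥0∞) (j : ℤ) : ℝ≥0∞ :=
  dyad j ^ (-(3 / 2) : ℝ) * (∫⁻ η, lowPart j a η) ^ 2 +
    dyad j ^ (1 / 2 : ℝ) * ∫⁻ η, highPart j a η ^ 2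

theorem exists_setLIntegral_annulus_corr_le :
    ∃ K : ℝ≥0∞, K ≠ ∞ ∧ ∀ a b : E2 → ℝ≥0∞, Measurable a → Measurable b → ∀ j : ℤ,
      (dyad j)⁻¹ * ∫⁻ ξ in annulus j, (∫⁻ η, a η * b (η + ξ)) ^ 2
        ≤ K * (scaleSq a j * scaleSq b j) := by
  set vB := volume (Metric.ball (0 : E2) 1) with hvB
  have hvB' : vB ≠ ∞ := measure_ball_lt_top.ne
  refine ⟨9 * (1 + 64 * vB), by finiteness, fun a b ha hb j => ?_⟩
  have hla := measurable_lowPart j ha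
  have hlb := measurable_lowPart j hb
  have hha := measurable_highPart j ha
  have hhb := measurable_highPart j hb
  set A1 := ∫⁻ η, lowPart j a η with hA1
  set A2 := ∫⁻ η, highPart j a η ^ 2 with hA2
  set B1 := ∫⁻ η, lowPart j b η with hB1
  set B2 := ∫⁻ η, highPart j b η ^ 2 with hB2
  have hmain : ∫⁻ ξ in annulus j, (∫⁻ η, a η * b (η + ξ)) ^ 2 ≤
      9 * (A1 ^ 2 * B2 + B1 ^ 2 * A2 + A2 * B2 * (64 * dyad j ^ 2 * vB)) := by
    have hm1 : Measurable fun ξ => ∫⁻ η, lowPart j a η * highPart j b (η + ξ) :=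
      Measurable.lintegral_prod_right' (f := fun p : E2 × E2 =>
        lowPart j a p.2 * highPart j b (p.2 + p.1)) (by fun_prop)
    have hm2 : Measurable fun ξ => ∫⁻ η, highPart j a η * lowPart j b (η + ξ) :=
      Measurable.lintegral_prod_right' (f := fun p : E2 × E2 =>
        highPart j a p.2 * lowPart j b (p.2 + p.1)) (by fun_prop)
    calc _ ≤ ∫⁻ ξ in annulus j, 9 * ((∫⁻ η, lowPart j a η * highPart j b (η + ξ)) ^ 2 +
          (∫⁻ η, highPart j a η * lowPart j b (η + ξ)) ^ 2 + A2 * B2) := by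
          refine setLIntegral_mono' (measurableSet_annulus j) fun ξ hξ => ?_
          have h1 : ∫⁻ η, a η * b (η + ξ) ≤ (∫⁻ η, lowPart j a η * highPart j b (η + ξ)) +
              (∫⁻ η, highPart j a η * lowPart j b (η + ξ)) +
              ∫⁻ η, highPart j a η * highPart j b (η + ξ) := by
            rw [← lintegral_add_left (by fun_prop), ← lintegral_add_left (by fun_prop)]
            exact lintegral_mono fun η => mul_le_of_mem_annulus hξ η
          have h2 : (∫⁻ η, highPart j a η * highPart j b (η + ξ)) ^ 2 ≤ A2 * B2 := by
            refine (sq_lintegral_mul_le volume (by fun_prop) (by fun_prop)).trans_eq ?_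
            rw [lintegral_add_right_eq_self (fun x => highPart j b x ^ 2)]
          refine (pow_le_pow_left' h1 2).trans ((sq_add_add_le _ _ _).trans ?_)
          gcongr
      _ = 9 * ((∫⁻ ξ in annulus j, (∫⁻ η, lowPart j a η * highPart j b (η + ξ)) ^ 2) +
          (∫⁻ ξ in annulus j, (∫⁻ η, highPart j a η * lowPart j b (η + ξ)) ^ 2) +
          A2 * B2 * volume (annulus j)) := by
          rw [lintegral_const_mul _ (by fun_prop), lintegral_add_left (by fun_prop),
            lintegral_add_left (by fun_prop), setLIntegral_const]
      _ ≤ _ := by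
          gcongr
          · exact (setLIntegral_le_lintegral _ _).trans (lintegral_sq_corr_le hla hhb)
          · exact (setLIntegral_le_lintegral _ _).trans (lintegral_sq_corr_le' hlb hha)
          · exact volume_annulus_le j
  have e1 : (dyad j)⁻¹ = dyad j ^ (-(3 / 2) : ℝ) * dyad j ^ (1 / 2 : ℝ) := by
    rw [← ENNReal.rpow_add _ _ (dyad_ne_zero j) (dyad_ne_top j), ← ENNReal.rpow_neg_one]
    norm_num
  have e2 : (dyad j)⁻¹ * dyad j ^ 2 = dyad j ^ (1 / 2 : ℝ) * dyad j ^ (1 / 2 : ℝ) := by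
    rw [← ENNReal.rpow_add _ _ (dyad_ne_zero j) (dyad_ne_top j), sq, ← mul_assoc,
      ENNReal.inv_mul_cancel (dyad_ne_zero j) (dyad_ne_top j)]
    norm_num
  unfold scaleSq
  rw [← hA1, ← hA2, ← hB1, ← hB2]
  set w := dyad j ^ (1 / 2 : ℝ)
  set w' := dyad j ^ (-(3 / 2) : ℝ)
  calc _ ≤ (dyad j)⁻¹ * (9 * (A1 ^ 2 * B2 + B1 ^ 2 * A2 + A2 * B2 * (64 * dyad j ^ 2 * vB))) := by
        gcongr
    _ = 9 * ((dyad j)⁻¹ * (A1 ^ 2 * B2 + B1 ^ 2 * A2) +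
          64 * vB * ((dyad j)⁻¹ * dyad j ^ 2) * (A2 * B2)) := by ring
    _ = 9 * ((w' * A1 ^ 2) * (w * B2) + (w * A2) * (w' * B1 ^ 2) +
          64 * vB * ((w * A2) * (w * B2))) := by rw [e2, e1]; ring
    _ ≤ 9 * ((w' * A1 ^ 2) * (w * B2) + (w * A2) * (w' * B1 ^ 2) +
          64 * vB * ((w * A2) * (w * B2))) +
        9 * ((w' * A1 ^ 2) * (w' * B1 ^ 2) + w * A2 * (w * B2) + 64 * vB *
          ((w' * A1 ^ 2) * (w' * B1 ^ 2) + (w' * A1 ^ 2) * (w * B2) +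
            (w * A2) * (w' * B1 ^ 2))) := le_self_add
    _ = _ := by ring

theorem exists_tsum_scaleSq_le :
    ∃ K : ℝ≥0∞, K ≠ ∞ ∧ ∀ a : E2 → ℝ≥0∞, Measurable a →
      ∑' j, scaleSq a j ≤ K * ∫⁻ η, ‖η‖ₑ ^ (1 / 2 : ℝ) * a η ^ 2 := by
  obtain ⟨K1, hK1, h1⟩ := exists_tsum_dyad_le_enorm (s := 1 / 2) (by norm_num)
  obtain ⟨K2, hK2, h2⟩ := exists_tsum_dyad_neg_le_enorm (s := 1 / 2) (by norm_num)
  obtain ⟨K3, hK3, h3⟩ := exists_setLIntegral_inv_enorm_le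
  refine ⟨K3 * K2 + K1, by finiteness, fun a ha => ?_⟩
  have hae : ∀ᵐ x : E2, x ≠ 0 := by simp [ae_iff]
  have hhigh : ∑' j, dyad j ^ (1 / 2 : ℝ) * ∫⁻ η, highPart j a η ^ 2 ≤
      K1 * ∫⁻ η, ‖η‖ₑ ^ (1 / 2 : ℝ) * a η ^ 2 := by
    calc _ = ∑' j, ∫⁻ η, dyad j ^ (1 / 2 : ℝ) * highPart j a η ^ 2 := by
          refine tsum_congr fun j => ?_
          have := measurable_highPart j ha
          rw [lintegral_const_mul _ (by fun_prop)]
      _ = ∫⁻ η, ∑' j, dyad j ^ (1 / 2 : ℝ) * highPart j a η ^ 2 := by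
          rw [lintegral_tsum]
          intro j
          have := measurable_highPart j ha
          fun_prop
      _ ≤ ∫⁻ η, K1 * (‖η‖ₑ ^ (1 / 2 : ℝ) * a η ^ 2) := by
          refine lintegral_mono fun η => ?_
          rw [← mul_assoc]
          refine le_trans (le_of_eq ?_) (mul_le_mul_left (h1 η) _)
          rw [← ENNReal.tsum_mul_right]
          refine tsum_congr fun j => ?_
          by_cases h : (2 : ℝ) ^ j ≤ ‖η‖
          · rw [if_pos h, highPart, Set.indicator_of_mem]
            simpa using h
          · rw [if_neg h, highPart, Set.indicator_of_notMem]
            · simp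
            · simpa using h
      _ = _ := lintegral_const_mul _ (by fun_prop)
  have hlow1 : ∀ j, dyad j ^ (-(3 / 2) : ℝ) * (∫⁻ η, lowPart j a η) ^ 2 ≤
      K3 * ∫⁻ η, dyad j ^ (-(1 / 2) : ℝ) * (‖η‖ₑ * lowPart j a η ^ 2) := by
    intro j
    have hl := measurable_lowPart j ha
    have hcs : (∫⁻ η, lowPart j a η) ^ 2 ≤
        (∫⁻ η, ‖η‖ₑ * lowPart j a η ^ 2) * (K3 * dyad j) := by
      have hs2 : ∀ t : ℝ≥0∞, (t ^ (1 / 2 : ℝ)) ^ 2 = t := fun t => by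
        rw [← ENNReal.rpow_natCast, ← ENNReal.rpow_mul]; norm_num
      set B := Metric.ball (0 : E2) ((2 : ℝ) ^ j) with hB
      have := sq_lintegral_mul_le (volume.restrict B)
        (f := fun η : E2 => ‖η‖ₑ ^ (1 / 2 : ℝ) * lowPart j a η)
        (g := fun η : E2 => (‖η‖ₑ⁻¹) ^ (1 / 2 : ℝ)) (by fun_prop) (by fun_prop)
      simp only [mul_pow, hs2] at this
      have e : ∫⁻ η, lowPart j a η =
          ∫⁻ η in B, ‖η‖ₑ ^ (1 / 2 : ℝ) * lowPart j a η * (‖η‖ₑ⁻¹) ^ (1 / 2 : ℝ) := by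
        rw [lowPart, lintegral_indicator measurableSet_ball]
        refine setLIntegral_congr_fun_ae measurableSet_ball ?_
        filter_upwards [hae] with η hη hηB
        rw [Set.indicator_of_mem hηB, mul_right_comm,
          ← ENNReal.mul_rpow_of_nonneg _ _ (by norm_num),
          ENNReal.mul_inv_cancel (enorm_ne_zero.2 hη) enorm_ne_top, ENNReal.one_rpow, one_mul]
      rw [e]
      refine this.trans ?_
      gcongr
      · exact Measure.restrict_le_self
      · exact h3 j
    rw [lintegral_const_mul _ (by fun_prop)]
    calc _ ≤ dyad j ^ (-(3 / 2) : ℝ) * ((∫⁻ η, ‖η‖ₑ * lowPart j a η ^ 2) * (K3 * dyad j)) := by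
          gcongr
      _ = K3 * ((dyad j ^ (-(3 / 2) : ℝ) * dyad j ^ (1 : ℝ)) *
            ∫⁻ η, ‖η‖ₑ * lowPart j a η ^ 2) := by rw [ENNReal.rpow_one]; ring
      _ = _ := by
          rw [← ENNReal.rpow_add _ _ (dyad_ne_zero j) (dyad_ne_top j)]
          norm_num
  have hlow : ∑' j, dyad j ^ (-(3 / 2) : ℝ) * (∫⁻ η, lowPart j a η) ^ 2 ≤
      K3 * K2 * ∫⁻ η, ‖η‖ₑ ^ (1 / 2 : ℝ) * a η ^ 2 := by
    calc _ ≤ ∑' j, K3 * ∫⁻ η, dyad j ^ (-(1 / 2) : ℝ) * (‖η‖ₑ * lowPart j a η ^ 2) :=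
          ENNReal.tsum_le_tsum hlow1
      _ = K3 * ∫⁻ η, ∑' j, dyad j ^ (-(1 / 2) : ℝ) * (‖η‖ₑ * lowPart j a η ^ 2) := by
          rw [ENNReal.tsum_mul_left, lintegral_tsum]
          intro j
          have := measurable_lowPart j ha
          fun_prop
      _ ≤ K3 * ∫⁻ η, K2 * (‖η‖ₑ ^ (1 / 2 : ℝ) * a η ^ 2) := by
          gcongr 1
          refine lintegral_mono_ae ?_
          filter_upwards [hae] with η hη
          calc ∑' j, dyad j ^ (-(1 / 2) : ℝ) * (‖η‖ₑ * lowPart j a η ^ 2)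
              = (∑' j : ℤ, if ‖η‖ < (2 : ℝ) ^ j then dyad j ^ (-(1 / 2) : ℝ) else 0) *
                  (‖η‖ₑ * a η ^ 2) := by
                rw [← ENNReal.tsum_mul_right]
                refine tsum_congr fun j => ?_
                by_cases h : ‖η‖ < (2 : ℝ) ^ j
                · rw [if_pos h, lowPart, Set.indicator_of_mem]
                  simpa using h
                · rw [if_neg h, lowPart, Set.indicator_of_notMem]
                  · simp
                  · simpa using h
            _ ≤ K2 * ‖η‖ₑ ^ (-(1 / 2) : ℝ) * (‖η‖ₑ * a η ^ 2) := mul_le_mul_left (h2 η hη) _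
            _ = K2 * ((‖η‖ₑ ^ (-(1 / 2) : ℝ) * ‖η‖ₑ ^ (1 : ℝ)) * a η ^ 2) := by
                rw [ENNReal.rpow_one]; ring
            _ = _ := by
                rw [← ENNReal.rpow_add _ _ (enorm_ne_zero.2 hη) enorm_ne_top]
                norm_num
      _ = _ := by rw [lintegral_const_mul _ (by fun_prop), mul_assoc]
  unfold scaleSq
  rw [ENNReal.tsum_add, add_mul]
  exact add_le_add hlow hhigh

theorem exists_tsum_annulus_corr_le :
    ∃ K : ℝ≥0∞, K ≠ ∞ ∧ ∀ a b : E2 → ℝ≥0∞, Measurable a → Measurable b →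
      ∑' j, ((dyad j)⁻¹ * ∫⁻ ξ in annulus j, (∫⁻ η, a η * b (η + ξ)) ^ 2) ^ (1 / 2 : ℝ)
        ≤ K * ((∫⁻ η, ‖η‖ₑ ^ (1 / 2 : ℝ) * a η ^ 2) *
            ∫⁻ η, ‖η‖ₑ ^ (1 / 2 : ℝ) * b η ^ 2) ^ (1 / 2 : ℝ) := by
  obtain ⟨K1, hK1, h1⟩ := exists_setLIntegral_annulus_corr_le
  obtain ⟨K2, hK2, h2⟩ := exists_tsum_scaleSq_le
  refine ⟨K1 ^ (1 / 2 : ℝ) * K2, by finiteness, fun a b ha hb => ?_⟩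
  have hh : (0 : ℝ) ≤ 1 / 2 := by norm_num
  calc _ ≤ ∑' j, K1 ^ (1 / 2 : ℝ) * (scaleSq a j ^ (1 / 2 : ℝ) * scaleSq b j ^ (1 / 2 : ℝ)) := by
        refine ENNReal.tsum_le_tsum fun j => ?_
        rw [← ENNReal.mul_rpow_of_nonneg _ _ hh, ← ENNReal.mul_rpow_of_nonneg _ _ hh]
        exact ENNReal.rpow_le_rpow (h1 a b ha hb j) hh
    _ ≤ K1 ^ (1 / 2 : ℝ) * ((∑' j, scaleSq a j) ^ (1 / 2 : ℝ) *
          (∑' j, scaleSq b j) ^ (1 / 2 : ℝ)) := by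
        rw [ENNReal.tsum_mul_left]
        gcongr
        exact tsum_sqrt_mul_sqrt_le _ _
    _ ≤ K1 ^ (1 / 2 : ℝ) * ((K2 * ∫⁻ η, ‖η‖ₑ ^ (1 / 2 : ℝ) * a η ^ 2) ^ (1 / 2 : ℝ) *
          (K2 * ∫⁻ η, ‖η‖ₑ ^ (1 / 2 : ℝ) * b η ^ 2) ^ (1 / 2 : ℝ)) := by
        gcongr
        · exact h2 a ha
        · exact h2 b hb
    _ = _ := by
        rw [ENNReal.mul_rpow_of_nonneg _ _ hh, ENNReal.mul_rpow_of_nonneg _ _ hh,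
          ENNReal.mul_rpow_of_nonneg _ _ hh, mul_mul_mul_comm,
          ← ENNReal.rpow_add_of_nonneg _ _ hh hh]
        norm_num [mul_assoc]

end Bilinear

section LittlewoodPaley

variable {χ : E2 → ℝ}

theorem cutoff_nonneg (hsupp : ∀ ξ, 2 ≤ ‖ξ‖ → χ ξ = 0) (hmono : ∀ ξ ζ, ‖ξ‖ ≤ ‖ζ‖ → χ ζ ≤ χ ξ)
    (ξ : E2) : 0 ≤ χ ξ := by
  rcases le_total 2 ‖ξ‖ with h | h
  · exact (hsupp ξ h).ge
  · have h2 : ‖(EuclideanSpace.single 0 2 : E2)‖ = 2 := by simp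
    exact (hsupp _ h2.ge).ge.trans (hmono ξ _ (h.trans h2.ge))

theorem cutoff_le_one (hone : ∀ ξ, ‖ξ‖ ≤ 1 → χ ξ = 1) (hmono : ∀ ξ ζ, ‖ξ‖ ≤ ‖ζ‖ → χ ζ ≤ χ ξ)
    (ξ : E2) : χ ξ ≤ 1 :=
  (hmono 0 ξ (by simp)).trans_eq (hone 0 (by simp))

theorem continuous_lpSymbol (hχ : Continuous χ) (j : ℤ) : Continuous (lpSymbol χ j) := by
  unfold lpSymbol
  split_ifs <;> fun_prop

theorem lpSymbol_of_nonneg {j : ℤ} (hj : 0 ≤ j) (ξ : E2) :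
    lpSymbol χ j ξ = χ ((2 : ℝ) ^ (-j) • ξ) - χ ((2 : ℝ) ^ (1 - j) • ξ) := by
  rw [lpSymbol, if_neg (by lia), if_pos hj, ← Int.cast_neg, Real.rpow_intCast,
    show (1 : ℝ) - j = ((1 - j : ℤ) : ℝ) by push_cast; ring, Real.rpow_intCast]

theorem norm_zpow_smul (n : ℤ) (ξ : E2) : ‖(2 : ℝ) ^ n • ξ‖ = (2 : ℝ) ^ n * ‖ξ‖ := by
  rw [norm_smul, Real.norm_of_nonneg (by positivity)]

theorem lpSymbol_eq_zero (hsupp : ∀ ξ, 2 ≤ ‖ξ‖ → χ ξ = 0) {j : ℤ} {ξ : E2}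
    (h1 : (2 : ℝ) ^ (j + 1) ≤ ‖ξ‖) (h2 : 2 ≤ ‖ξ‖) : lpSymbol χ j ξ = 0 := by
  rcases le_or_gt 0 j with hj | hj
  · have key : ∀ k : ℤ, 1 ≤ k + (j + 1) → 2 ≤ ‖(2 : ℝ) ^ k • ξ‖ := fun k hk => by
      rw [norm_zpow_smul]
      calc (2 : ℝ) = 2 ^ (1 : ℤ) := by norm_num
        _ ≤ 2 ^ (k + (j + 1)) := zpow_le_zpow_right₀ one_le_two hk
        _ = 2 ^ k * 2 ^ (j + 1) := zpow_add₀ two_ne_zero _ _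
        _ ≤ _ := by gcongr
    rw [lpSymbol_of_nonneg hj, hsupp _ (key _ (by lia)), hsupp _ (key _ (by lia)), sub_zero]
  · rw [lpSymbol, if_neg hj.not_ge, hsupp ξ h2, ite_self]

theorem hasCompactSupport_lpSymbol (hsupp : ∀ ξ, 2 ≤ ‖ξ‖ → χ ξ = 0) (j : ℤ) :
    HasCompactSupport (lpSymbol χ j) := by
  refine HasCompactSupport.intro (isCompact_closedBall 0 (max ((2 : ℝ) ^ (j + 1)) 2)) fun ξ hξ => ?_
  rw [mem_closedBall_zero_iff, not_le, max_lt_iff] at hξ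
  exact lpSymbol_eq_zero hsupp hξ.1.le hξ.2.le

theorem enorm_lpSymbol_le_indicator (hsupp : ∀ ξ, 2 ≤ ‖ξ‖ → χ ξ = 0)
    (hone : ∀ ξ, ‖ξ‖ ≤ 1 → χ ξ = 1) (hmono : ∀ ξ ζ, ‖ξ‖ ≤ ‖ζ‖ → χ ζ ≤ χ ξ)
    {j : ℤ} (hj : 0 ≤ j) (ξ : E2) :
    ‖lpSymbol χ j ξ‖ₑ ≤ (annulus (j - 2)).indicator 1 ξ := by
  by_cases hξ : ξ ∈ annulus (j - 2)
  · rw [Set.indicator_of_mem hξ, Pi.one_apply, lpSymbol_of_nonneg hj, Real.enorm_of_nonneg]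
    · refine ENNReal.ofReal_le_one.2 ?_
      linarith [cutoff_le_one hone hmono ((2 : ℝ) ^ (-j) • ξ),
        cutoff_nonneg hsupp hmono ((2 : ℝ) ^ (1 - j) • ξ)]
    · refine sub_nonneg.2 (hmono _ _ ?_)
      rw [norm_zpow_smul, norm_zpow_smul]
      gcongr
      · exact one_le_two
      · lia
  · rw [Set.indicator_of_notMem hξ, nonpos_iff_eq_zero, enorm_eq_zero]
    rcases le_or_gt ((2 : ℝ) ^ (j + 1)) ‖ξ‖ with h | h
    · refine lpSymbol_eq_zero hsupp h (le_trans ?_ h)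
      calc (2 : ℝ) = 2 ^ (1 : ℤ) := by norm_num
        _ ≤ 2 ^ (j + 1) := zpow_le_zpow_right₀ one_le_two (by lia)
    · have h' : ‖ξ‖ ≤ (2 : ℝ) ^ (j - 1) := by
        by_contra! hc
        refine hξ ⟨?_, ?_⟩
        · rw [show j - 2 + 1 = j - 1 by ring]; exact hc.le
        · rwa [show j - 2 + 3 = j + 1 by ring]
      have key : ∀ k : ℤ, k + (j - 1) ≤ 0 → ‖(2 : ℝ) ^ k • ξ‖ ≤ 1 := fun k hk => by
        rw [norm_zpow_smul]
        calc (2 : ℝ) ^ k * ‖ξ‖ ≤ 2 ^ k * 2 ^ (j - 1) := by gcongr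
          _ = 2 ^ (k + (j - 1)) := (zpow_add₀ two_ne_zero _ _).symm
          _ ≤ 1 := zpow_le_one_of_nonpos₀ one_le_two hk
      rw [lpSymbol_of_nonneg hj, hone _ (key _ (by lia)), hone _ (key _ (by lia)), sub_self]

theorem eLpNorm_lpBlock_le (hχ : Continuous χ) (hsupp : ∀ ξ, 2 ≤ ‖ξ‖ → χ ξ = 0) (j : ℤ)
    {f : E2 → ℂ} (hf : Integrable f) {F : E2 → ℝ≥0∞} (hF : ∀ ξ, ‖𝓕 f ξ‖ₑ ≤ F ξ)
    {S : Set E2} (hS : MeasurableSet S) (h : ∀ᵐ ξ, ‖lpSymbol χ j ξ‖ₑ ≤ S.indicator 1 ξ) :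
    eLpNorm (lpBlock χ j f) 2 volume ≤ (∫⁻ ξ in S, F ξ ^ 2) ^ (1 / 2 : ℝ) := by
  have hc : Continuous fun ξ => (lpSymbol χ j ξ : ℂ) * 𝓕 f ξ :=
    (Complex.continuous_ofReal.comp (continuous_lpSymbol hχ j)).mul
      (continuous_fourier_of_integrable hf)
  have hcs : HasCompactSupport fun ξ => (lpSymbol χ j ξ : ℂ) * 𝓕 f ξ :=
    ((hasCompactSupport_lpSymbol hsupp j).comp_left (g := fun x : ℝ => (x : ℂ))
      Complex.ofReal_zero).mul_right
  refine (eLpNorm_fourierInv_le (hc.integrable_of_hasCompactSupport hcs)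
    (hc.memLp_of_hasCompactSupport hcs)).trans ?_
  rw [eLpNorm_eq_lintegral_rpow_enorm_toReal two_ne_zero ENNReal.ofNat_ne_top, ENNReal.toReal_ofNat,
    ← lintegral_indicator hS]
  refine ENNReal.rpow_le_rpow (lintegral_mono_ae ?_) (by norm_num)
  filter_upwards [h] with ξ hξ
  rw [ENNReal.rpow_two, enorm_mul, show ‖(lpSymbol χ j ξ : ℂ)‖ₑ = ‖lpSymbol χ j ξ‖ₑ by
    rw [← ofReal_norm, ← ofReal_norm, Complex.norm_real]]
  by_cases hm : ξ ∈ S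
  · rw [Set.indicator_of_mem hm] at hξ ⊢
    gcongr
    calc _ ≤ 1 * F ξ := mul_le_mul' hξ (hF ξ)
      _ = F ξ := one_mul _
  · rw [Set.indicator_of_notMem hm, nonpos_iff_eq_zero] at hξ
    simp [hξ]

theorem sqrt_tsum_le (x : ℤ → ℝ≥0∞) :
    (∑' n, x n) ^ (1 / 2 : ℝ) ≤ ∑' n, x n ^ (1 / 2 : ℝ) := by
  have h : ∑' n, x n ≤ (∑' n, x n ^ (1 / 2 : ℝ)) ^ (2 : ℝ) := by
    rw [ENNReal.rpow_two, sq, ← ENNReal.tsum_mul_right]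
    refine ENNReal.tsum_le_tsum fun n => ?_
    calc x n = x n ^ (1 / 2 : ℝ) * x n ^ (1 / 2 : ℝ) := by
          rw [← ENNReal.rpow_add_of_nonneg _ _ (by norm_num) (by norm_num)]; norm_num
      _ ≤ _ := by gcongr; exact ENNReal.le_tsum n
  refine (ENNReal.rpow_le_rpow h (by norm_num)).trans_eq ?_
  rw [← ENNReal.rpow_mul]; norm_num

theorem besovNegHalfNorm_le_tsum (hχ : Continuous χ) (hsupp : ∀ ξ, 2 ≤ ‖ξ‖ → χ ξ = 0)
    (hone : ∀ ξ, ‖ξ‖ ≤ 1 → χ ξ = 1) (hmono : ∀ ξ ζ, ‖ξ‖ ≤ ‖ζ‖ → χ ζ ≤ χ ξ)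
    {f : E2 → ℂ} (hf : Integrable f) {F : E2 → ℝ≥0∞} (hF : ∀ ξ, ‖𝓕 f ξ‖ₑ ≤ F ξ) :
    besovNegHalfNorm χ f ≤
      3 * ∑' j, ((dyad j)⁻¹ * ∫⁻ ξ in annulus j, F ξ ^ 2) ^ (1 / 2 : ℝ) := by
  set N := fun j => ((dyad j)⁻¹ * ∫⁻ ξ in annulus j, F ξ ^ 2) ^ (1 / 2 : ℝ) with hN
  have hlow : eLpNorm (lpBlock χ (-1) f) 2 volume ≤ ∑' j, N j := by
    set A : ℤ → Set E2 := fun n => if n ≤ -2 then annulus n else ∅ with hA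
    have hAm : MeasurableSet (⋃ n, A n) := MeasurableSet.iUnion fun n => by
      simp only [hA]; split_ifs
      exacts [measurableSet_annulus n, MeasurableSet.empty]
    refine (eLpNorm_lpBlock_le hχ hsupp (-1) hf hF hAm ?_).trans ?_
    · have h0 : ∀ᵐ ξ : E2, ξ ≠ 0 := by simp [ae_iff]
      filter_upwards [h0] with ξ hξ
      rcases le_or_gt 2 ‖ξ‖ with h2 | h2
      · rw [lpSymbol_eq_zero hsupp (by norm_num; linarith) h2, enorm_zero]
        exact zero_le
      · obtain ⟨n, hn1, hn2⟩ := exists_dyad_le_lt hξ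
        have hn : n < 1 := by
          have : (2 : ℝ) ^ n < 2 ^ (1 : ℤ) := by simpa using hn1.trans_lt h2
          exact (zpow_lt_zpow_iff_right₀ one_lt_two).1 this
        have hm : ξ ∈ ⋃ n, A n := by
          refine Set.mem_iUnion.2 ⟨n - 2, ?_⟩
          simp only [hA]
          rw [if_pos (by lia)]
          refine ⟨(zpow_le_zpow_right₀ one_le_two (by lia)).trans hn1, ?_⟩
          rwa [show n - 2 + 3 = n + 1 by ring]
        rw [Set.indicator_of_mem hm, lpSymbol, if_pos rfl,
          Real.enorm_of_nonneg (cutoff_nonneg hsupp hmono ξ)]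
        exact ENNReal.ofReal_le_one.2 (cutoff_le_one hone hmono ξ)
    · refine (ENNReal.rpow_le_rpow (lintegral_iUnion_le A _) (by norm_num)).trans
        ((sqrt_tsum_le _).trans (ENNReal.tsum_le_tsum fun n => ?_))
      refine ENNReal.rpow_le_rpow ?_ (by norm_num)
      simp only [hA]
      split_ifs with hn
      · refine le_mul_of_one_le_left' (ENNReal.one_le_inv.2 ?_)
        rw [dyad]
        exact ENNReal.ofReal_le_one.2 (zpow_le_one_of_nonpos₀ one_le_two (by lia))
      · simp
  have hterm : ∀ j : ℤ, ENNReal.ofReal ((2 : ℝ) ^ (-(j : ℝ) / 2)) *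
      eLpNorm (lpBlock χ j f) 2 volume ≤ (if j = -1 then 2 * ∑' j, N j else 0) + N (j - 2) := by
    intro j
    rcases lt_trichotomy j (-1) with hj | rfl | hj
    · have : eLpNorm (lpBlock χ j f) 2 volume ≤ (∫⁻ ξ in (∅ : Set E2), F ξ ^ 2) ^ (1 / 2 : ℝ) := by
        refine eLpNorm_lpBlock_le hχ hsupp j hf hF MeasurableSet.empty (ae_of_all _ fun ξ => ?_)
        simp [lpSymbol, hj.ne, show ¬ 0 ≤ j by lia]
      have h0 : eLpNorm (lpBlock χ j f) 2 volume = 0 := by simpa using this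
      rw [h0, mul_zero]
      exact zero_le
    · rw [if_pos rfl]
      refine le_add_right (mul_le_mul' ?_ hlow)
      rw [← ENNReal.ofReal_ofNat 2]
      refine ENNReal.ofReal_le_ofReal ?_
      calc (2 : ℝ) ^ (-((-1 : ℤ) : ℝ) / 2) ≤ 2 ^ (1 : ℝ) :=
            Real.rpow_le_rpow_of_exponent_le one_le_two (by norm_num)
        _ = 2 := Real.rpow_one 2
    · rw [if_neg hj.ne', zero_add]
      have h1 := eLpNorm_lpBlock_le hχ hsupp j hf hF (measurableSet_annulus (j - 2))
        (ae_of_all _ (enorm_lpSymbol_le_indicator hsupp hone hmono (by lia)))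
      simp only [hN]
      rw [ENNReal.mul_rpow_of_nonneg _ _ (by norm_num)]
      refine mul_le_mul' ?_ h1
      rw [← dyad_neg, dyad, ENNReal.ofReal_rpow_of_pos (by positivity), ← Real.rpow_intCast,
        ← Real.rpow_mul (by norm_num)]
      refine ENNReal.ofReal_le_ofReal (Real.rpow_le_rpow_of_exponent_le one_le_two ?_)
      push_cast
      linarith
  calc besovNegHalfNorm χ f
      ≤ ∑' j : ℤ, ((if j = -1 then 2 * ∑' j, N j else 0) + N (j - 2)) :=
        ENNReal.tsum_le_tsum hterm
    _ = 2 * ∑' j, N j + ∑' j, N j := by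
        rw [ENNReal.tsum_add, tsum_ite_eq]
        exact congrArg _ ((Equiv.subRight (2 : ℤ)).tsum_eq N)
    _ = 3 * ∑' j, N j := by ring

end LittlewoodPaley

section ProductEstimate

variable {χ : E2 → ℝ}

theorem enorm_l2Fourier {f : E2 → ℝ} (hf : MemLp f 2) : ‖l2Fourier hf‖ₑ = eLpNorm f 2 volume := by
  rw [l2Fourier, ← ofReal_norm, Lp.norm_fourier_eq, ofReal_norm, Lp.enorm_toLp]
  refine eLpNorm_congr_norm_ae (ae_of_all _ fun x => ?_)
  exact Complex.norm_real _

theorem besovNegHalfNorm_eq_zero (hχ : Continuous χ) (hsupp : ∀ ξ, 2 ≤ ‖ξ‖ → χ ξ = 0)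
    (hone : ∀ ξ, ‖ξ‖ ≤ 1 → χ ξ = 1) (hmono : ∀ ξ ζ, ‖ξ‖ ≤ ‖ζ‖ → χ ζ ≤ χ ξ)
    {f : E2 → ℂ} (hf : f =ᵐ[volume] 0) : besovNegHalfNorm χ f = 0 := by
  have hF : ∀ ξ, ‖𝓕 f ξ‖ₑ ≤ (0 : E2 → ℝ≥0∞) ξ := fun ξ => by
    rw [Real.fourier_eq, integral_eq_zero_of_ae, enorm_zero, Pi.zero_apply]
    filter_upwards [hf] with x hx
    simp [hx]
  have := besovNegHalfNorm_le_tsum hχ hsupp hone hmono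
    ((integrable_zero E2 ℂ volume).congr hf.symm) hF
  simpa using this

theorem lintegral_sqrt_enorm_mul_sq_le {a : E2 → ℝ≥0∞} (ha : Measurable a) :
    ∫⁻ η, ‖η‖ₑ ^ (1 / 2 : ℝ) * a η ^ 2 ≤
      ((∫⁻ η, a η ^ 2) * ∫⁻ η, ‖η‖ₑ * a η ^ 2) ^ (1 / 2 : ℝ) := by
  have h := sq_lintegral_mul_le volume (f := a) (g := fun η => ‖η‖ₑ ^ (1 / 2 : ℝ) * a η)
    ha.aemeasurable (by fun_prop)
  have e1 : ∀ η : E2, a η * (‖η‖ₑ ^ (1 / 2 : ℝ) * a η) = ‖η‖ₑ ^ (1 / 2 : ℝ) * a η ^ 2 :=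
    fun η => by ring
  have e2 : ∀ η : E2, (‖η‖ₑ ^ (1 / 2 : ℝ) * a η) ^ 2 = ‖η‖ₑ * a η ^ 2 := fun η => by
    rw [mul_pow, ← ENNReal.rpow_two (‖η‖ₑ ^ (1 / 2 : ℝ)), ← ENNReal.rpow_mul]; norm_num
  simp only [e1, e2] at h
  rw [← ENNReal.rpow_two] at h
  refine le_of_eq_of_le ?_ (ENNReal.rpow_le_rpow (z := 1 / 2) h (by norm_num))
  rw [← ENNReal.rpow_mul]; norm_num

theorem exists_besovNegHalfNorm_mul_sq_le (hχ : Continuous χ) (hsupp : ∀ ξ, 2 ≤ ‖ξ‖ → χ ξ = 0)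
    (hone : ∀ ξ, ‖ξ‖ ≤ 1 → χ ξ = 1) (hmono : ∀ ξ ζ, ‖ξ‖ ≤ ‖ζ‖ → χ ζ ≤ χ ξ) :
    ∃ K : ℝ≥0∞, K ≠ ∞ ∧ ∀ θ u : E2 → ℝ, Measurable θ → Measurable u → MemLp θ 2 → MemLp u 2 →
      besovNegHalfNorm χ (fun x => ((θ x * u x : ℝ) : ℂ)) ^ 2 ≤
        K * (eLpNorm θ 2 volume * eLpNorm u 2 volume *
          (homHalfSq θ ^ (1 / 2 : ℝ) * homHalfSq u ^ (1 / 2 : ℝ))) := by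
  obtain ⟨K₁, hK₁, h₁⟩ := exists_lintegral_fourier_le_homHalfSq
  obtain ⟨K₂, hK₂, h₂⟩ := exists_tsum_annulus_corr_le
  refine ⟨(3 * K₂) ^ 2 * (K₁ ^ (1 / 2 : ℝ)) ^ 2, ?_, fun θ u hθm hum hθ hu => ?_⟩
  · exact ENNReal.mul_ne_top (ENNReal.pow_ne_top (ENNReal.mul_ne_top ENNReal.ofNat_ne_top hK₂))
      (ENNReal.pow_ne_top (ENNReal.rpow_ne_top_of_nonneg (by norm_num) hK₁))
  have hmeas : ∀ {f : E2 → ℝ} (hf : MemLp f 2), Measurable fun η => ‖l2Fourier hf η‖ₑ := fun hf =>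
    (Lp.stronglyMeasurable (l2Fourier hf)).measurable.enorm
  have hint : Integrable fun x => ((θ x * u x : ℝ) : ℂ) := (hθ.integrable_mul hu).ofReal
  have hbesov := besovNegHalfNorm_le_tsum hχ hsupp hone hmono hint (enorm_fourier_mul_le hθ hu)
  have hX : ∀ {f : E2 → ℝ} (hfm : Measurable f) (hf : MemLp f 2),
      ∫⁻ η, ‖η‖ₑ ^ (1 / 2 : ℝ) * ‖l2Fourier hf η‖ₑ ^ 2 ≤
        eLpNorm f 2 volume * (K₁ ^ (1 / 2 : ℝ) * homHalfSq f ^ (1 / 2 : ℝ)) := fun {f} hfm hf => by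
    refine (lintegral_sqrt_enorm_mul_sq_le (hmeas hf)).trans ?_
    rw [lintegral_enorm_sq_Lp, enorm_l2Fourier, ENNReal.mul_rpow_of_nonneg _ _ (by norm_num),
      ← ENNReal.rpow_two, ← ENNReal.rpow_mul, mul_one_div_cancel two_ne_zero, ENNReal.rpow_one,
      ← ENNReal.mul_rpow_of_nonneg _ _ (by norm_num)]
    gcongr
    exact h₁ f hfm hf
  set X := ∫⁻ η, ‖η‖ₑ ^ (1 / 2 : ℝ) * ‖l2Fourier hθ η‖ₑ ^ 2
  set Y := ∫⁻ η, ‖η‖ₑ ^ (1 / 2 : ℝ) * ‖l2Fourier hu η‖ₑ ^ 2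
  calc besovNegHalfNorm χ (fun x => ((θ x * u x : ℝ) : ℂ)) ^ 2
      ≤ (3 * (K₂ * (X * Y) ^ (1 / 2 : ℝ))) ^ 2 := by
        gcongr
        refine hbesov.trans ?_
        gcongr
        exact h₂ _ _ (hmeas hθ) (hmeas hu)
    _ = (3 * K₂) ^ 2 * (X * Y) := by
        rw [← mul_assoc, mul_pow, ← ENNReal.rpow_two ((X * Y) ^ (1 / 2 : ℝ)), ← ENNReal.rpow_mul]
        norm_num
    _ ≤ (3 * K₂) ^ 2 * ((eLpNorm θ 2 volume * (K₁ ^ (1 / 2 : ℝ) * homHalfSq θ ^ (1 / 2 : ℝ))) *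
          (eLpNorm u 2 volume * (K₁ ^ (1 / 2 : ℝ) * homHalfSq u ^ (1 / 2 : ℝ)))) := by
        gcongr
        · exact hX hθm hθ
        · exact hX hum hu
    _ = _ := by ring

theorem measurable_homHalfSq {θ : ℝ → E2 → ℝ} (hθ : Measurable (Function.uncurry θ)) :
    Measurable fun t => homHalfSq (θ t) := by
  unfold homHalfSq
  refine Measurable.lintegral_prod_right' (f := fun p : ℝ × E2 =>
    ∫⁻ y, (‖θ p.1 p.2 - θ p.1 y‖₊ : ℝ≥0∞) ^ 2 / ENNReal.ofReal (‖p.2 - y‖ ^ 3)) ?_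
  refine Measurable.lintegral_prod_right' (f := fun q : (ℝ × E2) × E2 =>
    (‖θ q.1.1 q.1.2 - θ q.1.1 q.2‖₊ : ℝ≥0∞) ^ 2 / ENNReal.ofReal (‖q.1.2 - q.2‖ ^ 3)) ?_
  have h1 : Measurable fun q : (ℝ × E2) × E2 => θ q.1.1 q.1.2 := hθ.comp measurable_fst
  have h2 : Measurable fun q : (ℝ × E2) × E2 => θ q.1.1 q.2 :=
    hθ.comp (measurable_fst.fst.prodMk measurable_snd)
  have h3 : Measurable fun q : (ℝ × E2) × E2 => ‖q.1.2 - q.2‖ :=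
    (measurable_fst.snd.sub measurable_snd).norm
  exact ((h1.sub h2).nnnorm.coe_nnreal_ennreal.pow_const 2).div (h3.pow_const 3).ennreal_ofReal

end ProductEstimate

/-- **Paraproduct estimate: `θu ∈ L²_T B^{-1/2}_{2,1}`.**
Let `θ, u ∈ L^∞([0,T]; L²) ∩ L²([0,T]; Ḣ^{1/2})` on the two-dimensional space `ℝ²`,
with norms bounded by `M_θ`, `M_u` respectively.  Then, for any Littlewood–Paley
cut-off `χ`, the product `θu` belongs to `L²([0,T]; B^{-1/2}_{2,1})` (hence to
`L²([0,T]; H^{-1/2})`, by the embedding `B^{-1/2}_{2,1} ↪ H^{-1/2}`), with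
`‖θu‖_{L²_T B^{-1/2}_{2,1}} ≤ C M_θ M_u`. -/
theorem product_in_L2T_Besov
    (χ : E2 → ℝ)
    (hχ_smooth : ContDiff ℝ (⊤ : ℕ∞) χ)
    (hχ_supp : ∀ ξ, 2 ≤ ‖ξ‖ → χ ξ = 0)
    (hχ_one : ∀ ξ, ‖ξ‖ ≤ 1 → χ ξ = 1)
    (hχ_radial : ∀ ξ ζ, ‖ξ‖ = ‖ζ‖ → χ ξ = χ ζ)
    (hχ_mono : ∀ ξ ζ, ‖ξ‖ ≤ ‖ζ‖ → χ ζ ≤ χ ξ) :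
    ∃ C : ℝ≥0∞, C ≠ ∞ ∧
      ∀ (T : ℝ), 0 < T →
      ∀ (θ u : ℝ → E2 → ℝ) (Mθ Mu : ℝ≥0∞),
        Measurable (Function.uncurry θ) → Measurable (Function.uncurry u) →
        (∀ t ∈ Set.Ioo 0 T, eLpNorm (θ t) 2 volume ≤ Mθ) →
        (∀ t ∈ Set.Ioo 0 T, eLpNorm (u t) 2 volume ≤ Mu) →
        (∫⁻ t in Set.Ioo (0 : ℝ) T, homHalfSq (θ t) ≤ Mθ ^ 2) →
        (∫⁻ t in Set.Ioo (0 : ℝ) T, homHalfSq (u t) ≤ Mu ^ 2) →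
        ∫⁻ t in Set.Ioo (0 : ℝ) T,
            (besovNegHalfNorm χ (fun x => ((θ t x * u t x : ℝ) : ℂ))) ^ 2
          ≤ C * Mθ ^ 2 * Mu ^ 2 := by
  have hχ := hχ_smooth.continuous
  obtain ⟨K, hK, hprod⟩ := exists_besovNegHalfNorm_mul_sq_le hχ hχ_supp hχ_one hχ_mono
  refine ⟨K + 1, ENNReal.add_ne_top.2 ⟨hK, ENNReal.one_ne_top⟩, ?_⟩
  intro T _ θ u Mθ Mu hθm hum hθ hu hθH huH
  have hθt : ∀ t, Measurable (θ t) := fun t => hθm.of_uncurry_left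
  have hut : ∀ t, Measurable (u t) := fun t => hum.of_uncurry_left
  have hzero : ∀ {f : E2 → ℝ}, Measurable f → eLpNorm f 2 volume ≤ 0 → f =ᵐ[volume] 0 :=
    fun hf h => (eLpNorm_eq_zero_iff hf.aestronglyMeasurable two_ne_zero).1 (nonpos_iff_eq_zero.1 h)
  rcases eq_or_ne Mθ 0 with rfl | hMθ0
  · rw [setLIntegral_congr_fun (g := fun _ => 0) measurableSet_Ioo fun t ht => ?_, lintegral_zero]
    · exact zero_le
    · rw [besovNegHalfNorm_eq_zero hχ hχ_supp hχ_one hχ_mono, zero_pow two_ne_zero]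
      filter_upwards [hzero (hθt t) (hθ t ht)] with x hx
      simp [hx]
  rcases eq_or_ne Mu 0 with rfl | hMu0
  · rw [setLIntegral_congr_fun (g := fun _ => 0) measurableSet_Ioo fun t ht => ?_, lintegral_zero]
    · exact zero_le
    · rw [besovNegHalfNorm_eq_zero hχ hχ_supp hχ_one hχ_mono, zero_pow two_ne_zero]
      filter_upwards [hzero (hut t) (hu t ht)] with x hx
      simp [hx]
  rcases eq_or_ne Mθ ∞ with rfl | hMθ
  · simp [ENNReal.top_mul, ENNReal.mul_top, hMu0]
  rcases eq_or_ne Mu ∞ with rfl | hMu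
  · simp [ENNReal.mul_top, hMθ0]
  have hHθ := (measurable_homHalfSq hθm).pow_const (1 / 2 : ℝ)
  have hHu := (measurable_homHalfSq hum).pow_const (1 / 2 : ℝ)
  have hsq : ∀ x : ℝ≥0∞, (x ^ (1 / 2 : ℝ)) ^ 2 = x := fun x => by
    rw [← ENNReal.rpow_two, ← ENNReal.rpow_mul]; norm_num
  have htime : ∫⁻ t in Set.Ioo (0 : ℝ) T,
      homHalfSq (θ t) ^ (1 / 2 : ℝ) * homHalfSq (u t) ^ (1 / 2 : ℝ) ≤ Mθ * Mu := by
    have h := sq_lintegral_mul_le (volume.restrict (Set.Ioo (0 : ℝ) T)) hHθ.aemeasurable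
      hHu.aemeasurable
    simp only [hsq] at h
    refine (ENNReal.pow_le_pow_left_iff two_ne_zero).1 (h.trans ?_)
    rw [mul_pow]
    exact mul_le_mul' hθH huH
  calc ∫⁻ t in Set.Ioo (0 : ℝ) T, besovNegHalfNorm χ (fun x => ((θ t x * u t x : ℝ) : ℂ)) ^ 2
      ≤ ∫⁻ t in Set.Ioo (0 : ℝ) T, K * (Mθ * Mu) *
          (homHalfSq (θ t) ^ (1 / 2 : ℝ) * homHalfSq (u t) ^ (1 / 2 : ℝ)) := by
        refine setLIntegral_mono' measurableSet_Ioo fun t ht => ?_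
        refine (hprod (θ t) (u t) (hθt t) (hut t)
          ⟨(hθt t).aestronglyMeasurable, (hθ t ht).trans_lt hMθ.lt_top⟩
          ⟨(hut t).aestronglyMeasurable, (hu t ht).trans_lt hMu.lt_top⟩).trans ?_
        rw [← mul_assoc K]
        gcongr
        · exact hθ t ht
        · exact hu t ht
    _ ≤ K * (Mθ * Mu) * (Mθ * Mu) := by
        exact (lintegral_const_mul _ (hHθ.mul hHu)).trans_le (by gcongr; exact htime)
    _ = K * Mθ ^ 2 * Mu ^ 2 := by ring
    _ ≤ (K + 1) * Mθ ^ 2 * Mu ^ 2 := by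
        gcongr
        exact le_self_add

end
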